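/- Let n ≥ 1, k > 0, δ > 0, g₁ > 0, and suppose there exist positive constants χ, λ₀, λ₁ such that Φ₀ is positive definite, Ψ₁ = −k + (1 + k²n)χ < 0, and Ψ₂ is negative definite. Then there exists γ > 0, depending only on (n, k, δ, g₁, χ, λ₀, λ₁), such that for every continuous boundary disturbance w on Γ_N × [t₀,∞) and every classical (C²) solution e of the perturbed error system — e_tt = Δe + g(x,t)e on Ω × (t₀,∞) with g continuous, |g| ≤ g₁, e = 0 on Γ_D, and e_{x_p} = −k e_t + w on each face {x_p = 1} — the following input-to-state stability bound holds for all t ≥ t₀: α E(t) ≤ β e^{−2δ(t−t₀)} E(t₀) + γ ∫_{t₀}^{t} ∫_{Γ_N} w(x,s)² dΓ ds, where E(t) = ½∫_Ω (|∇e(x,t)|² + e_t(x,t)²) dx, α = 2λ_min(Φ₀) and β = 2(1 + 4/(π²n))λ_max(Φ₁) + χk(n−1) with Φ₁ = Φ₀ + diag(4λ₀/(π²n), 0, 0). -/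

import Mathlib

open MeasureTheory Real Matrix

noncomputable section

/-- The closed unit hypercube `[0,1]^n`. -/
def cube (n : ℕ) : Set (Fin n → ℝ) := Set.univ.pi fun _ => Set.Icc (0:ℝ) 1

/-- Partial derivative of `u` in the `p`-th coordinate direction. -/
def pd {n : ℕ} (p : Fin n) (u : (Fin n → ℝ) → ℝ) (x : Fin n → ℝ) : ℝ :=
  fderiv ℝ u x (Pi.single p 1)

/-- Squared Euclidean norm of the gradient, `|∇u|²`. -/
def gradSq {n : ℕ} (u : (Fin n → ℝ) → ℝ) (x : Fin n → ℝ) : ℝ := ∑ p, (pd p u x) ^ 2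

/-- Laplacian `Δu = Σ_p u_{x_p x_p}`. -/
def lap {n : ℕ} (u : (Fin n → ℝ) → ℝ) (x : Fin n → ℝ) : ℝ := ∑ p, pd p (pd p u) x

/-- Surface integral over `Γ_N`: `Σ_p ∫_{[0,1]^{n-1}} h|_{x_p = 1} dx'`
(each face integral realized as an integral over the cube of a function
independent of the `p`-th coordinate). -/
def faceInt {n : ℕ} (h : (Fin n → ℝ) → ℝ) : ℝ :=
  ∑ p : Fin n, ∫ x in cube n, h (Function.update x p 1)

/-- `xᵀ∇u`. -/
def xGrad {n : ℕ} (u : (Fin n → ℝ) → ℝ) (x : Fin n → ℝ) : ℝ := ∑ p, x p * pd p u x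

/-- Minimal eigenvalue of a symmetric matrix, via the Rayleigh quotient. -/
def lamMin (M : Matrix (Fin 3) (Fin 3) ℝ) : ℝ :=
  sInf {r | ∃ v : Fin 3 → ℝ, (∑ i, (v i) ^ 2) = 1 ∧ r = v ⬝ᵥ M.mulVec v}

/-- Maximal eigenvalue of a symmetric matrix, via the Rayleigh quotient. -/
def lamMax (M : Matrix (Fin 3) (Fin 3) ℝ) : ℝ :=
  sSup {r | ∃ v : Fin 3 → ℝ, (∑ i, (v i) ^ 2) = 1 ∧ r = v ⬝ᵥ M.mulVec v}

/-- Negative definiteness. -/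
def NegDefM {m : ℕ} (M : Matrix (Fin m) (Fin m) ℝ) : Prop := (-M).PosDef

/-- Negative semidefiniteness. -/
def NegSemidefM {m : ℕ} (M : Matrix (Fin m) (Fin m) ℝ) : Prop := (-M).PosSemidef

/-- The matrix `Φ₀` of LMI (12). -/
def Phi0 (n : ℕ) (χ lam0 : ℝ) : Matrix (Fin 3) (Fin 3) ℝ :=
  !![1/2 - 4*lam0/(π^2*n), Real.sqrt n * χ, 0;
     Real.sqrt n * χ, 1/2, ((n:ℝ)-1)*χ/2;
     0, ((n:ℝ)-1)*χ/2, lam0]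

/-- `Φ₁ = Φ₀ + diag(4λ₀/(π²n), 0, 0)`. -/
def Phi1 (n : ℕ) (χ lam0 : ℝ) : Matrix (Fin 3) (Fin 3) ℝ :=
  Phi0 n χ lam0 + Matrix.diagonal ![4*lam0/(π^2*n), 0, 0]

/-- The matrix `Ψ₂` of LMI (14). -/
def Psi2 (n : ℕ) (k χ δ g1 lam1 : ℝ) : Matrix (Fin 3) (Fin 3) ℝ :=
  !![-χ + δ*(1 + χ*k*((n:ℝ)-1)) + 4*lam1/(π^2*n), 2*δ*Real.sqrt n*χ, Real.sqrt n*g1*χ;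
     2*δ*Real.sqrt n*χ, -χ + δ, g1/2 + δ*((n:ℝ)-1)*χ;
     Real.sqrt n*g1*χ, g1/2 + δ*((n:ℝ)-1)*χ, -lam1 + g1*((n:ℝ)-1)*χ]

/-- The matrix `Φ` of the exact-observability LMI (32), with `σ = e^{-2δT*}`. -/
def PhiM (n : ℕ) (χ σ lam2 : ℝ) : Matrix (Fin 3) (Fin 3) ℝ :=
  !![-(1-σ)/2 + 4*lam2/(π^2*n), Real.sqrt n*(1+σ)*χ, 0;
     Real.sqrt n*(1+σ)*χ, -(1-σ)/2, ((n:ℝ)-1)*(1+σ)*χ/2;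
     0, ((n:ℝ)-1)*(1+σ)*χ/2, -lam2]

/-- `α = 2λ_min(Φ₀)`. -/
def alphaC (n : ℕ) (χ lam0 : ℝ) : ℝ := 2 * lamMin (Phi0 n χ lam0)

/-- `β = 2(1 + 4/(π²n))λ_max(Φ₁) + χk(n−1)`. -/
def betaC (n : ℕ) (k χ lam0 : ℝ) : ℝ :=
  2 * (1 + 4/(π^2*n)) * lamMax (Phi1 n χ lam0) + χ*k*((n:ℝ)-1)

section CubeIntegrals

variable {n : ℕ}

lemma isCompact_cube (n : ℕ) : IsCompact (cube n) :=
  isCompact_univ_pi fun _ => isCompact_Icc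

lemma measurableSet_cube (n : ℕ) : MeasurableSet (cube n) :=
  (isCompact_cube n).measurableSet

lemma update_mem_cube {x : Fin n → ℝ} (hx : x ∈ cube n) (p : Fin n) {s : ℝ}
    (hs : s ∈ Set.Icc (0 : ℝ) 1) : Function.update x p s ∈ cube n := by
  intro i _
  by_cases h : i = p
  · subst h; simpa using hs
  · simpa [h] using hx i (Set.mem_univ i)

lemma Continuous.integrableOn_cube {f : (Fin n → ℝ) → ℝ} (hf : Continuous f) :
    IntegrableOn f (cube n) :=
  hf.continuousOn.integrableOn_compact (isCompact_cube n)

lemma integral_cube_mono {f g : (Fin n → ℝ) → ℝ} (hf : Continuous f) (hg : Continuous g)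
    (h : ∀ x ∈ cube n, f x ≤ g x) : ∫ x in cube n, f x ≤ ∫ x in cube n, g x :=
  setIntegral_mono_on hf.integrableOn_cube hg.integrableOn_cube (measurableSet_cube n) h

lemma measurePreserving_update (p : Fin n) (ν : Fin n → Measure ℝ)
    [∀ i, IsProbabilityMeasure (ν i)] :
    MeasurePreserving (fun q : (Fin n → ℝ) × ℝ => Function.update q.1 p q.2)
      ((Measure.pi ν).prod (ν p)) (Measure.pi ν) := by
  have hm : Measurable fun q : (Fin n → ℝ) × ℝ => Function.update q.1 p q.2 :=
    (continuous_fst.update p continuous_snd).measurable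
  refine ⟨hm, (Measure.pi_eq fun s hs => ?_).symm⟩
  rw [Measure.map_apply hm (MeasurableSet.univ_pi hs)]
  have hpre : (fun q : (Fin n → ℝ) × ℝ => Function.update q.1 p q.2) ⁻¹' Set.univ.pi s =
      (Set.univ.pi (Function.update s p Set.univ)) ×ˢ s p := by
    ext q
    simp only [Set.mem_preimage, Set.mem_pi, Set.mem_univ, forall_true_left, Set.mem_prod]
    constructor
    · intro h
      refine ⟨fun i => ?_, by simpa using h p⟩
      by_cases hi : i = p
      · subst hi; simp
      · simpa [hi] using h i
    · rintro ⟨h1, h2⟩ i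
      by_cases hi : i = p
      · subst hi; simpa using h2
      · simpa [hi] using h1 i
  rw [hpre, Measure.prod_prod, Measure.pi_pi,
    ← Finset.mul_prod_erase _ _ (Finset.mem_univ p),
    ← Finset.mul_prod_erase (Finset.univ) (fun i => ν i (s i)) (Finset.mem_univ p)]
  simp only [Function.update_self, measure_univ, one_mul]
  rw [mul_comm]
  congr 1
  refine Finset.prod_congr rfl fun i hi => ?_
  rw [Function.update_of_ne (Finset.ne_of_mem_erase hi)]

/-- Fubini along one coordinate direction of the cube. -/
lemma integral_cube_eq_integral_line (p : Fin n) {f : (Fin n → ℝ) → ℝ} (hf : Continuous f) :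
    ∫ x in cube n, f x =
      ∫ x in cube n, ∫ s in (0 : ℝ)..1, f (Function.update x p s) := by
  have hprob : IsProbabilityMeasure ((volume : Measure ℝ).restrict (Set.Icc 0 1)) :=
    ⟨by simp⟩
  have hcube : (volume : Measure (Fin n → ℝ)).restrict (cube n) =
      Measure.pi fun _ => (volume : Measure ℝ).restrict (Set.Icc 0 1) :=
    Measure.restrict_pi_pi (fun _ => (volume : Measure ℝ)) fun _ => Set.Icc 0 1
  have hmp := measurePreserving_update p
    fun _ : Fin n => (volume : Measure ℝ).restrict (Set.Icc 0 1)
  have hint := hf.integrableOn_cube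
  rw [IntegrableOn, hcube] at hint
  rw [hcube]
  have hint' := hmp.integrable_comp_of_integrable hint
  calc ∫ x, f x ∂(Measure.pi fun _ => (volume : Measure ℝ).restrict (Set.Icc 0 1))
      = ∫ q, f (Function.update q.1 p q.2)
          ∂((Measure.pi fun _ => (volume : Measure ℝ).restrict (Set.Icc 0 1)).prod
            (volume.restrict (Set.Icc 0 1))) := by
        rw [← integral_map hmp.measurable.aemeasurable hf.aestronglyMeasurable, hmp.map_eq]
    _ = _ := by
        refine (integral_prod _ hint').trans ?_
        refine integral_congr_ae (Filter.Eventually.of_forall fun x => ?_)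
        simp only [Function.comp_apply]
        rw [intervalIntegral.integral_of_le zero_le_one, integral_Icc_eq_integral_Ioc]

end CubeIntegrals

section LineInequalities

/-- Wirtinger inequality on the unit interval for functions vanishing at the left end. -/
lemma integral_sq_le_of_eq_zero_left {f f' : ℝ → ℝ} (hf : ∀ s, HasDerivAt f (f' s) s)
    (hf' : Continuous f') (h0 : f 0 = 0) :
    π ^ 2 / 4 * ∫ s in (0 : ℝ)..1, f s ^ 2 ≤ ∫ s in (0 : ℝ)..1, f' s ^ 2 := by
  have hfc : Continuous f := continuous_iff_continuousAt.2 fun s => (hf s).continuousAt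
  have key : ∀ a ∈ Set.Ioo (0 : ℝ) (π / 2),
      a ^ 2 * ∫ s in (0 : ℝ)..1, f s ^ 2 ≤ ∫ s in (0 : ℝ)..1, f' s ^ 2 := by
    rintro a ⟨ha0, ha⟩
    have hcos : ∀ s ∈ Set.uIcc (0 : ℝ) 1, Real.cos (a * (1 - s)) ≠ 0 := by
      intro s hs
      rw [Set.uIcc_of_le zero_le_one] at hs
      refine (Real.cos_pos_of_mem_Ioo ⟨?_, ?_⟩).ne' <;> nlinarith [hs.1, hs.2]
    have hder : ∀ s ∈ Set.uIcc (0 : ℝ) 1,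
        HasDerivAt (fun s => a * Real.tan (a * (1 - s)) * f s ^ 2)
          ((f' s ^ 2 - a ^ 2 * f s ^ 2) - (f' s - a * Real.tan (a * (1 - s)) * f s) ^ 2) s := by
      intro s hs
      have h1 : HasDerivAt (fun s : ℝ => a * (1 - s)) (a * (-1)) s :=
        ((hasDerivAt_id s).const_sub 1).const_mul a
      have h2 := (((Real.hasDerivAt_tan (hcos s hs)).comp s h1).const_mul a).mul ((hf s).pow 2)
      refine h2.congr_deriv ?_
      have h3 : 1 / Real.cos (a * (1 - s)) ^ 2 = 1 + Real.tan (a * (1 - s)) ^ 2 := by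
        have := hcos s hs
        rw [Real.tan_eq_sin_div_cos]
        field_simp
        rw [Real.cos_sq_add_sin_sq]
      simp only [Function.comp_apply, h3, Pi.pow_apply]
      push_cast
      ring
    have htan : ContinuousOn (fun s => Real.tan (a * (1 - s))) (Set.uIcc (0 : ℝ) 1) := by
      intro s hs
      exact ((Real.continuousAt_tan.2 (hcos s hs)).comp
        (f := fun s : ℝ => a * (1 - s)) (by fun_prop)).continuousWithinAt
    have hI1 : IntervalIntegrable (fun s => f' s ^ 2 - a ^ 2 * f s ^ 2) volume 0 1 :=
      (by fun_prop : Continuous fun s => f' s ^ 2 - a ^ 2 * f s ^ 2).intervalIntegrable _ _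
    have hI2 : IntervalIntegrable
        (fun s => (f' s - a * Real.tan (a * (1 - s)) * f s) ^ 2) volume 0 1 :=
      ContinuousOn.intervalIntegrable
        ((hf'.continuousOn.sub ((continuousOn_const.mul htan).mul hfc.continuousOn)).pow 2)
    have hftc := intervalIntegral.integral_eq_sub_of_hasDerivAt hder (hI1.sub hI2)
    rw [intervalIntegral.integral_sub hI1 hI2,
      intervalIntegral.integral_sub
        ((by fun_prop : Continuous fun s => f' s ^ 2).intervalIntegrable _ _)
        ((by fun_prop : Continuous fun s => a ^ 2 * f s ^ 2).intervalIntegrable _ _),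
      intervalIntegral.integral_const_mul] at hftc
    simp only [sub_self, mul_zero, Real.tan_zero, zero_mul, h0, ne_eq, OfNat.ofNat_ne_zero,
      not_false_eq_true, zero_pow] at hftc
    have hnn : 0 ≤ ∫ s in (0 : ℝ)..1, (f' s - a * Real.tan (a * (1 - s)) * f s) ^ 2 :=
      intervalIntegral.integral_nonneg zero_le_one fun s _ => sq_nonneg _
    linarith
  have hlim : Filter.Tendsto (fun a : ℝ => a ^ 2 * ∫ s in (0 : ℝ)..1, f s ^ 2)
      (nhdsWithin (π / 2) (Set.Iio (π / 2)))
      (nhds ((π / 2) ^ 2 * ∫ s in (0 : ℝ)..1, f s ^ 2)) :=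
    ((by fun_prop : Continuous fun a : ℝ => a ^ 2 * ∫ s in (0 : ℝ)..1, f s ^ 2).tendsto
      _).mono_left nhdsWithin_le_nhds
  have := le_of_tendsto hlim
    (Filter.mem_of_superset (Ioo_mem_nhdsLT Real.pi_div_two_pos) key)
  calc _ = (π / 2) ^ 2 * ∫ s in (0 : ℝ)..1, f s ^ 2 := by ring
    _ ≤ _ := this

/-- Trace inequality on the unit interval for functions vanishing at the left end. -/
lemma sq_le_integral_sq_of_eq_zero_left {f f' : ℝ → ℝ} (hf : ∀ s, HasDerivAt f (f' s) s)
    (hf' : Continuous f') (h0 : f 0 = 0) : f 1 ^ 2 ≤ ∫ s in (0 : ℝ)..1, f' s ^ 2 := by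
  have hftc := intervalIntegral.integral_eq_sub_of_hasDerivAt (fun s _ => hf s)
    (hf'.intervalIntegrable 0 1)
  rw [h0, sub_zero] at hftc
  have hnn : 0 ≤ ∫ s in (0 : ℝ)..1, (f' s - f 1) ^ 2 :=
    intervalIntegral.integral_nonneg zero_le_one fun s _ => sq_nonneg _
  have hexp : ∫ s in (0 : ℝ)..1, (f' s - f 1) ^ 2 =
      (∫ s in (0 : ℝ)..1, f' s ^ 2) - 2 * f 1 * (∫ s in (0 : ℝ)..1, f' s) + f 1 ^ 2 := by
    rw [← intervalIntegral.integral_const_mul, ← intervalIntegral.integral_sub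
      ((by fun_prop : Continuous fun s => f' s ^ 2).intervalIntegrable _ _)
      ((by fun_prop : Continuous fun s => 2 * f 1 * f' s).intervalIntegrable _ _)]
    have : f 1 ^ 2 = ∫ _ in (0 : ℝ)..1, f 1 ^ 2 := by simp
    rw [this, ← intervalIntegral.integral_add
      ((by fun_prop : Continuous fun s => f' s ^ 2 - 2 * f 1 * f' s).intervalIntegrable _ _)
      (by simp)]
    congr 1
    ext s
    ring
  rw [hexp, hftc] at hnn
  linarith

end LineInequalities

section PartialDerivatives

variable {n : ℕ}

lemma DifferentiableAt.hasDerivAt_pd {u : (Fin n → ℝ) → ℝ} {x : Fin n → ℝ} {p : Fin n} {s : ℝ}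
    (hu : DifferentiableAt ℝ u (Function.update x p s)) :
    HasDerivAt (fun s => u (Function.update x p s)) (pd p u (Function.update x p s)) s :=
  hu.hasFDerivAt.comp_hasDerivAt s (hasDerivAt_update x p s)

lemma ContDiff.continuous_pd {u : (Fin n → ℝ) → ℝ} (hu : ContDiff ℝ 1 u) (p : Fin n) :
    Continuous (pd p u) :=
  (hu.continuous_fderiv one_ne_zero).clm_apply continuous_const

lemma ContDiff.contDiff_pd {u : (Fin n → ℝ) → ℝ} (hu : ContDiff ℝ 2 u) (p : Fin n) :
    ContDiff ℝ 1 (pd p u) :=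
  (hu.fderiv_right (m := 1) (by norm_num)).clm_apply contDiff_const

lemma ContDiff.pd_comm {u : (Fin n → ℝ) → ℝ} (hu : ContDiff ℝ 2 u) (p q : Fin n)
    (x : Fin n → ℝ) : pd p (pd q u) x = pd q (pd p u) x := by
  have hsymm : IsSymmSndFDerivAt ℝ u x :=
    hu.contDiffAt.isSymmSndFDerivAt (by simp)
  have hd : DifferentiableAt ℝ (fderiv ℝ u) x :=
    (hu.fderiv_right (m := 1) (by norm_num)).differentiable one_ne_zero x
  have h : ∀ a b : Fin n, pd a (pd b u) x =
      fderiv ℝ (fderiv ℝ u) x (Pi.single a 1) (Pi.single b 1) := by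
    intro a b
    change fderiv ℝ (fun y => fderiv ℝ u y (Pi.single b 1)) x (Pi.single a 1) = _
    rw [fderiv_clm_apply hd (differentiableAt_const _)]
    simp
  rw [h, h, hsymm.eq]

lemma pd_add {u v : (Fin n → ℝ) → ℝ} {x : Fin n → ℝ} (p : Fin n)
    (hu : DifferentiableAt ℝ u x) (hv : DifferentiableAt ℝ v x) :
    pd p (fun y => u y + v y) x = pd p u x + pd p v x := by
  simp [pd, fderiv_fun_add hu hv]

lemma pd_sub {u v : (Fin n → ℝ) → ℝ} {x : Fin n → ℝ} (p : Fin n)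
    (hu : DifferentiableAt ℝ u x) (hv : DifferentiableAt ℝ v x) :
    pd p (fun y => u y - v y) x = pd p u x - pd p v x := by
  simp [pd, fderiv_fun_sub hu hv]

lemma pd_mul {u v : (Fin n → ℝ) → ℝ} {x : Fin n → ℝ} (p : Fin n)
    (hu : DifferentiableAt ℝ u x) (hv : DifferentiableAt ℝ v x) :
    pd p (fun y => u y * v y) x = u x * pd p v x + v x * pd p u x := by
  simp [pd, fderiv_fun_mul hu hv]

lemma pd_const_mul {u : (Fin n → ℝ) → ℝ} {x : Fin n → ℝ} (p : Fin n) (c : ℝ)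
    (hu : DifferentiableAt ℝ u x) : pd p (fun y => c * u y) x = c * pd p u x := by
  simp [pd, fderiv_const_mul hu]

lemma pd_sq {u : (Fin n → ℝ) → ℝ} {x : Fin n → ℝ} (p : Fin n)
    (hu : DifferentiableAt ℝ u x) : pd p (fun y => u y ^ 2) x = 2 * u x * pd p u x := by
  simp only [pow_two]
  rw [pd_mul p hu hu]
  ring

lemma pd_sum {ι : Type*} (s : Finset ι) {u : ι → (Fin n → ℝ) → ℝ} {x : Fin n → ℝ} (p : Fin n)
    (hu : ∀ i ∈ s, DifferentiableAt ℝ (u i) x) :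
    pd p (fun y => ∑ i ∈ s, u i y) x = ∑ i ∈ s, pd p (u i) x := by
  simp [pd, fderiv_fun_sum hu]

lemma pd_coord (p q : Fin n) (x : Fin n → ℝ) :
    pd p (fun y => y q) x = if q = p then 1 else 0 := by
  have : fderiv ℝ (fun y : Fin n → ℝ => y q) x = ContinuousLinearMap.proj q :=
    (ContinuousLinearMap.proj (R := ℝ) (φ := fun _ : Fin n => ℝ) q).fderiv
  simp [pd, this, Pi.single_apply]

lemma ContDiff.contDiff_xGrad {u : (Fin n → ℝ) → ℝ} (hu : ContDiff ℝ 2 u) :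
    ContDiff ℝ 1 (xGrad u) :=
  ContDiff.sum fun p _ => (contDiff_apply ℝ ℝ p).mul (hu.contDiff_pd p)

lemma ContDiff.contDiff_gradSq {u : (Fin n → ℝ) → ℝ} (hu : ContDiff ℝ 2 u) :
    ContDiff ℝ 1 (gradSq u) :=
  ContDiff.sum fun p _ => (hu.contDiff_pd p).pow 2

lemma ContDiff.continuous_xGrad {u : (Fin n → ℝ) → ℝ} (hu : ContDiff ℝ 1 u) :
    Continuous (xGrad u) :=
  continuous_finsetSum _ fun p _ => (continuous_apply p).mul (hu.continuous_pd p)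

lemma gradSq_nonneg (u : (Fin n → ℝ) → ℝ) (x : Fin n → ℝ) : 0 ≤ gradSq u x :=
  Finset.sum_nonneg fun _ _ => sq_nonneg _

lemma pd_xGrad {u : (Fin n → ℝ) → ℝ} (hu : ContDiff ℝ 2 u) (p : Fin n) (x : Fin n → ℝ) :
    pd p (xGrad u) x = pd p u x + ∑ q, x q * pd p (pd q u) x := by
  have hd : ∀ q, DifferentiableAt ℝ (pd q u) x := fun q =>
    (hu.contDiff_pd q).differentiable one_ne_zero x
  change pd p (fun y => ∑ q, y q * pd q u y) x = _
  rw [pd_sum _ _ fun q _ => by fun_prop]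
  have : ∀ q, pd p (fun y => y q * pd q u y) x =
      x q * pd p (pd q u) x + if q = p then pd q u x else 0 := by
    intro q
    rw [pd_mul p (by fun_prop) (hd q), pd_coord]
    simp
  simp only [this, Finset.sum_add_distrib, Finset.sum_ite_eq', Finset.mem_univ, if_true]
  ring

lemma pd_gradSq {u : (Fin n → ℝ) → ℝ} (hu : ContDiff ℝ 2 u) (p : Fin n) (x : Fin n → ℝ) :
    pd p (gradSq u) x = ∑ q, 2 * pd q u x * pd p (pd q u) x := by
  have hd : ∀ q, DifferentiableAt ℝ (pd q u) x := fun q =>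
    (hu.contDiff_pd q).differentiable one_ne_zero x
  change pd p (fun y => ∑ q, pd q u y ^ 2) x = _
  rw [pd_sum _ _ fun q _ => by fun_prop]
  exact Finset.sum_congr rfl fun q _ => pd_sq p (hd q)

/-- Cauchy-Schwarz for `xᵀ∇u` on the unit cube. -/
lemma sq_xGrad_le (u : (Fin n → ℝ) → ℝ) {x : Fin n → ℝ} (hx : x ∈ cube n) :
    xGrad u x ^ 2 ≤ n * gradSq u x := by
  have h := Finset.sum_mul_sq_le_sq_mul_sq Finset.univ x fun p => pd p u x
  refine h.trans (mul_le_mul_of_nonneg_right ?_ (gradSq_nonneg u x))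
  calc ∑ p, x p ^ 2 ≤ ∑ _p : Fin n, (1 : ℝ) := Finset.sum_le_sum fun p _ => by
        have := hx p (Set.mem_univ p)
        exact pow_le_one₀ this.1 this.2
    _ = n := by simp

lemma abs_xGrad_le (u : (Fin n → ℝ) → ℝ) {x : Fin n → ℝ} (hx : x ∈ cube n) :
    |xGrad u x| ≤ √n * √(gradSq u x) := by
  rw [← Real.sqrt_mul (Nat.cast_nonneg n)]
  exact Real.abs_le_sqrt (sq_xGrad_le u hx)

end PartialDerivatives

section SpatialInequalities

variable {n : ℕ}

/-- Integration of a partial derivative over the cube. -/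
lemma integral_cube_pd {u : (Fin n → ℝ) → ℝ} (hu : ContDiff ℝ 1 u) (p : Fin n) :
    ∫ x in cube n, pd p u x =
      ∫ x in cube n, (u (Function.update x p 1) - u (Function.update x p 0)) := by
  rw [integral_cube_eq_integral_line p (hu.continuous_pd p)]
  refine integral_congr_ae (Filter.Eventually.of_forall fun x => ?_)
  have hc : Continuous fun s : ℝ => pd p u (Function.update x p s) :=
    (hu.continuous_pd p).comp (continuous_const.update p continuous_id)
  exact intervalIntegral.integral_eq_sub_of_hasDerivAt
    (fun s _ => (hu.differentiable one_ne_zero _).hasDerivAt_pd) (hc.intervalIntegrable 0 1)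

/-- Functions vanishing on the faces through the origin. -/
def VanishesOnDirichletFaces (u : (Fin n → ℝ) → ℝ) : Prop :=
  ∀ x ∈ cube n, (∃ p, x p = 0) → u x = 0

lemma VanishesOnDirichletFaces.update_zero {u : (Fin n → ℝ) → ℝ}
    (h0 : VanishesOnDirichletFaces u) {x : Fin n → ℝ} (hx : x ∈ cube n) (p : Fin n) :
    u (Function.update x p 0) = 0 :=
  h0 _ (update_mem_cube hx p ⟨le_rfl, zero_le_one⟩) ⟨p, by simp⟩

lemma continuous_integral_line {f : (Fin n → ℝ) → ℝ} (hf : Continuous f) (p : Fin n) :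
    Continuous fun x => ∫ s in (0 : ℝ)..1, f (Function.update x p s) :=
  intervalIntegral.continuous_parametric_intervalIntegral_of_continuous'
    (f := fun x s => f (Function.update x p s))
    (hf.comp (continuous_fst.update p continuous_snd)) 0 1

lemma wirtinger_cube {u : (Fin n → ℝ) → ℝ} (hu : ContDiff ℝ 1 u)
    (h0 : VanishesOnDirichletFaces u) (p : Fin n) :
    π ^ 2 / 4 * ∫ x in cube n, u x ^ 2 ≤ ∫ x in cube n, pd p u x ^ 2 := by
  have hpd := hu.continuous_pd p
  have huc := hu.continuous
  rw [integral_cube_eq_integral_line p (by fun_prop : Continuous fun x => u x ^ 2),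
    integral_cube_eq_integral_line p (by fun_prop : Continuous fun x => pd p u x ^ 2),
    ← integral_const_mul]
  refine integral_cube_mono ?_ ?_ fun x hx => ?_
  · exact continuous_const.mul (continuous_integral_line (huc.pow 2) p)
  · exact continuous_integral_line (hpd.pow 2) p
  · exact integral_sq_le_of_eq_zero_left
      (fun s => (hu.differentiable one_ne_zero _).hasDerivAt_pd)
      (hpd.comp (continuous_const.update p continuous_id)) (h0.update_zero hx p)

/-- Wirtinger (Poincaré) inequality on the cube. -/
lemma poincare_cube (hn : 1 ≤ n) {u : (Fin n → ℝ) → ℝ} (hu : ContDiff ℝ 1 u)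
    (h0 : VanishesOnDirichletFaces u) :
    ∫ x in cube n, u x ^ 2 ≤ 4 / (π ^ 2 * n) * ∫ x in cube n, gradSq u x := by
  have hsum : ∑ p : Fin n, π ^ 2 / 4 * ∫ x in cube n, u x ^ 2 ≤
      ∑ p : Fin n, ∫ x in cube n, pd p u x ^ 2 :=
    Finset.sum_le_sum fun p _ => wirtinger_cube hu h0 p
  have hpd : ∀ p, Continuous fun x => pd p u x ^ 2 := fun p => (hu.continuous_pd p).pow 2
  rw [← integral_finsetSum _ fun p _ => (hpd p).integrableOn_cube] at hsum
  simp only [Finset.sum_const, Finset.card_univ, Fintype.card_fin, nsmul_eq_mul] at hsum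
  have hn' : (0 : ℝ) < n := by exact_mod_cast hn
  have hpi := Real.pi_pos
  change _ ≤ ∫ x in cube n, gradSq u x at hsum
  rw [div_mul_eq_mul_div, le_div_iff₀ (by positivity)]
  linarith

/-- Trace inequality on the Neumann faces. -/
lemma trace_cube {u : (Fin n → ℝ) → ℝ} (hu : ContDiff ℝ 1 u)
    (h0 : VanishesOnDirichletFaces u) :
    ∫ x in cube n, ∑ p, u (Function.update x p 1) ^ 2 ≤ ∫ x in cube n, gradSq u x := by
  have huc := hu.continuous
  have hpd : ∀ p, Continuous fun x => pd p u x ^ 2 := fun p => (hu.continuous_pd p).pow 2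
  have hface : ∀ p : Fin n, Continuous fun x => u (Function.update x p 1) ^ 2 := fun p =>
    (huc.comp (continuous_id.update p continuous_const)).pow 2
  unfold gradSq
  rw [integral_finsetSum _ fun p _ => (hface p).integrableOn_cube,
    integral_finsetSum _ fun p _ => (hpd p).integrableOn_cube]
  refine Finset.sum_le_sum fun p _ => ?_
  rw [integral_cube_eq_integral_line p (hpd p)]
  refine integral_cube_mono (hface p) ?_ fun x hx => ?_
  · exact continuous_integral_line (hpd p) p
  · exact sq_le_integral_sq_of_eq_zero_left
      (fun s => (hu.differentiable one_ne_zero _).hasDerivAt_pd)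
      ((hu.continuous_pd p).comp (continuous_const.update p continuous_id)) (h0.update_zero hx p)

/-- Tangential derivatives vanish on the Dirichlet faces. -/
lemma VanishesOnDirichletFaces.pd_eq_zero {u : (Fin n → ℝ) → ℝ} (hu : Differentiable ℝ u)
    (h0 : VanishesOnDirichletFaces u) {x : Fin n → ℝ} (hx : x ∈ cube n) {p q : Fin n}
    (hxp : x p = 0) (hqp : q ≠ p) : pd q u x = 0 := by
  have hxq := hx q (Set.mem_univ q)
  have h1 : HasDerivAt (fun s => u (Function.update x q s)) (pd q u x) (x q) := by
    have h := (hu (Function.update x q (x q))).hasDerivAt_pd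
    rwa [Function.update_eq_self] at h
  have h2 : HasDerivWithinAt (fun s => u (Function.update x q s)) 0 (Set.Icc 0 1) (x q) := by
    refine (hasDerivWithinAt_const (x q) (Set.Icc (0 : ℝ) 1) (0 : ℝ)).congr_of_mem
      (fun s hs => ?_) hxq
    exact h0 _ (update_mem_cube hx q hs) ⟨p, by simp [hqp.symm, hxp]⟩
  exact (uniqueDiffOn_Icc zero_lt_one _ hxq).eq_deriv _ h1.hasDerivWithinAt h2

end SpatialInequalities

section Flux

variable {n : ℕ}

/-- The multiplier flux whose divergence produces the energy dissipation. -/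
def flux (χ : ℝ) (u v : (Fin n → ℝ) → ℝ) (p : Fin n) (x : Fin n → ℝ) : ℝ :=
  v x * pd p u x + χ * (x p * v x ^ 2 + 2 * (xGrad u x * pd p u x) - x p * gradSq u x +
    ((n : ℝ) - 1) * (u x * pd p u x))

lemma contDiff_flux (χ : ℝ) {u v : (Fin n → ℝ) → ℝ} (hu : ContDiff ℝ 2 u) (hv : ContDiff ℝ 1 v)
    (p : Fin n) : ContDiff ℝ 1 (flux χ u v p) := by
  have h1 := hu.contDiff_pd p
  have h2 := hu.contDiff_xGrad
  have h3 := hu.contDiff_gradSq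
  have h4 : ContDiff ℝ 1 u := hu.of_le one_le_two
  unfold flux
  fun_prop

lemma sum_pd_flux (χ : ℝ) {u v : (Fin n → ℝ) → ℝ} (hu : ContDiff ℝ 2 u) (hv : ContDiff ℝ 1 v)
    (x : Fin n → ℝ) :
    ∑ p, pd p (flux χ u v p) x =
      ∑ p, pd p u x * pd p v x + v x * lap u x +
        χ * (2 * v x * xGrad v x + n * v x ^ 2 +
          (2 * xGrad u x + ((n : ℝ) - 1) * u x) * lap u x + gradSq u x) := by
  have d1 : ∀ p, DifferentiableAt ℝ (pd p u) x := fun p =>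
    (hu.contDiff_pd p).differentiable one_ne_zero x
  have d2 : DifferentiableAt ℝ (xGrad u) x := hu.contDiff_xGrad.differentiable one_ne_zero x
  have d3 : DifferentiableAt ℝ (gradSq u) x := hu.contDiff_gradSq.differentiable one_ne_zero x
  have d4 : DifferentiableAt ℝ u x := hu.differentiable two_ne_zero x
  have d5 : DifferentiableAt ℝ v x := hv.differentiable one_ne_zero x
  obtain ⟨A, hA⟩ : ∃ A : Fin n → ℝ,
      A = fun p => ∑ q, 2 * pd p u x * (x q * pd p (pd q u) x) := ⟨_, rfl⟩
  obtain ⟨B, hB⟩ : ∃ B : Fin n → ℝ,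
      B = fun p => ∑ q, 2 * pd q u x * (x p * pd q (pd p u) x) := ⟨_, rfl⟩
  have h : ∀ p, pd p (flux χ u v p) x =
      pd p u x * pd p v x + v x * pd p (pd p u) x + χ * (
        2 * v x * (x p * pd p v x) + v x ^ 2 +
        (2 * xGrad u x + ((n : ℝ) - 1) * u x) * pd p (pd p u) x + (n + 1) * pd p u x ^ 2
        - gradSq u x
        + (A p - B p)) := by
    intro p
    rw [hA, hB]
    dsimp only
    have dc : DifferentiableAt ℝ (fun y : Fin n → ℝ => y p) x := by fun_prop
    have e1 : ∑ q, 2 * pd p u x * (x q * pd p (pd q u) x) =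
        2 * pd p u x * ∑ q, x q * pd p (pd q u) x := by rw [Finset.mul_sum]
    have e2 : ∑ q, 2 * pd q u x * (x p * pd q (pd p u) x) =
        x p * ∑ q, 2 * pd q u x * pd p (pd q u) x := by
      rw [Finset.mul_sum]
      refine Finset.sum_congr rfl fun q _ => ?_
      rw [hu.pd_comm q p]
      ring
    unfold flux
    rw [pd_add p (by fun_prop) (by fun_prop), pd_mul p d5 (d1 p),
      pd_const_mul p χ (by fun_prop), pd_add p (by fun_prop) (by fun_prop),
      pd_sub p (by fun_prop) (by fun_prop), pd_add p (by fun_prop) (by fun_prop),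
      pd_mul p dc (by fun_prop), pd_sq p d5, pd_const_mul p 2 (by fun_prop), pd_mul p d2 (d1 p),
      pd_mul p dc d3, pd_const_mul p _ (by fun_prop), pd_mul p d4 (d1 p), pd_coord, pd_xGrad hu,
      pd_gradSq hu, e1, e2, if_pos rfl]
    ring
  have hswap : ∑ p, A p = ∑ p, B p := by
    rw [hA, hB]
    exact Finset.sum_comm
  simp only [h, Finset.sum_add_distrib, Finset.sum_sub_distrib, ← Finset.mul_sum, hswap,
    Finset.sum_const, Finset.card_univ, Fintype.card_fin, nsmul_eq_mul]
  change _ + v x * lap u x + χ * (2 * v x * xGrad v x + _ + _ * lap u x +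
    (n + 1) * gradSq u x - _ + _) = _
  ring

lemma flux_update_zero (χ : ℝ) {u v : (Fin n → ℝ) → ℝ} (hu : ContDiff ℝ 2 u)
    (hu0 : VanishesOnDirichletFaces u) (hv0 : VanishesOnDirichletFaces v) {x : Fin n → ℝ}
    (hx : x ∈ cube n) (p : Fin n) : flux χ u v p (Function.update x p 0) = 0 := by
  have hy : Function.update x p 0 ∈ cube n := update_mem_cube hx p ⟨le_rfl, zero_le_one⟩
  have hyp : Function.update x p 0 p = 0 := by simp
  have hX : xGrad u (Function.update x p 0) = 0 := by
    refine Finset.sum_eq_zero fun q _ => ?_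
    by_cases hq : q = p
    · subst hq; simp
    · rw [hu0.pd_eq_zero (hu.differentiable two_ne_zero) hy hyp hq, mul_zero]
  simp [flux, hX, hu0.update_zero hx p, hv0.update_zero hx p]

lemma integral_sum_pd_flux (χ : ℝ) {u v : (Fin n → ℝ) → ℝ} (hu : ContDiff ℝ 2 u)
    (hv : ContDiff ℝ 1 v) (hu0 : VanishesOnDirichletFaces u)
    (hv0 : VanishesOnDirichletFaces v) :
    ∫ x in cube n, ∑ p, pd p (flux χ u v p) x =
      ∫ x in cube n, ∑ p, flux χ u v p (Function.update x p 1) := by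
  have hF := contDiff_flux χ hu hv
  have hface : ∀ p, Continuous fun x => flux χ u v p (Function.update x p 1) := fun p =>
    (hF p).continuous.comp (continuous_id.update p continuous_const)
  rw [integral_finsetSum _ fun p _ => ((hF p).continuous_pd p).integrableOn_cube,
    integral_finsetSum _ fun p _ => (hface p).integrableOn_cube]
  refine Finset.sum_congr rfl fun p _ => ?_
  rw [integral_cube_pd (hF p) p]
  refine setIntegral_congr_fun (measurableSet_cube n) fun x hx => ?_
  simp [flux_update_zero χ hu hu0 hv0 hx p]

end Flux

section QuadraticForms

lemma exists_pos_mul_sum_sq_le_of_posDef {M : Matrix (Fin 3) (Fin 3) ℝ} (hM : M.PosDef) :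
    ∃ ε > 0, ∀ v : Fin 3 → ℝ, ε * ∑ i, v i ^ 2 ≤ v ⬝ᵥ M.mulVec v := by
  have hcont : Continuous fun v : Fin 3 → ℝ => v ⬝ᵥ M.mulVec v := by fun_prop
  have hclosed : IsClosed {v : Fin 3 → ℝ | ∑ i, v i ^ 2 = 1} :=
    isClosed_eq (by fun_prop) continuous_const
  have hsub : {v : Fin 3 → ℝ | ∑ i, v i ^ 2 = 1} ⊆ Set.univ.pi fun _ => Set.Icc (-1) 1 := by
    intro v hv i _
    rw [Set.mem_Icc, ← abs_le, ← sq_le_one_iff_abs_le_one]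
    exact (Finset.single_le_sum (f := fun i => v i ^ 2) (fun j _ => sq_nonneg _)
      (Finset.mem_univ i)).trans_eq hv
  have hcomp : IsCompact {v : Fin 3 → ℝ | ∑ i, v i ^ 2 = 1} :=
    (isCompact_univ_pi fun _ => isCompact_Icc).of_isClosed_subset hclosed hsub
  obtain ⟨v₀, hv₀, hmin⟩ := hcomp.exists_isMinOn
    ⟨![1, 0, 0], by simp [Fin.sum_univ_three]⟩ hcont.continuousOn
  have hv₀ne : v₀ ≠ 0 := by
    rintro rfl
    simp at hv₀
  refine ⟨v₀ ⬝ᵥ M.mulVec v₀, by simpa using hM.dotProduct_mulVec_pos hv₀ne, fun v => ?_⟩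
  have hS : 0 ≤ ∑ i, v i ^ 2 := Finset.sum_nonneg fun _ _ => sq_nonneg _
  rcases hS.eq_or_lt with h | h
  · rw [← h, mul_zero]
    simpa using hM.posSemidef.dotProduct_mulVec_nonneg v
  · set r := √(∑ i, v i ^ 2) with hr
    have hr0 : 0 < r := Real.sqrt_pos.2 h
    have hr2 : r ^ 2 = ∑ i, v i ^ 2 := Real.sq_sqrt hS
    have hmem : ∑ i, (r⁻¹ • v) i ^ 2 = 1 := by
      simp only [Pi.smul_apply, smul_eq_mul, mul_pow, ← Finset.mul_sum, ← hr2]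
      field_simp
    have := hmin hmem
    simp only [Set.mem_ofPred_eq, Matrix.mulVec_smul, dotProduct_smul, smul_dotProduct,
      smul_eq_mul] at this
    calc _ ≤ (r⁻¹ * (r⁻¹ * (v ⬝ᵥ M.mulVec v))) * ∑ i, v i ^ 2 :=
          mul_le_mul_of_nonneg_right this hS
      _ = _ := by rw [← hr2]; field_simp

lemma abs_rayleigh_le (M : Matrix (Fin 3) (Fin 3) ℝ) {v : Fin 3 → ℝ}
    (hv : ∑ i, v i ^ 2 = 1) : |v ⬝ᵥ M.mulVec v| ≤ ∑ i, ∑ j, |M i j| := by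
  have hvi : ∀ i, |v i| ≤ 1 := fun i => by
    rw [← sq_le_one_iff_abs_le_one]
    exact (Finset.single_le_sum (f := fun i => v i ^ 2) (fun j _ => sq_nonneg _)
      (Finset.mem_univ i)).trans_eq hv
  simp only [dotProduct, Matrix.mulVec, Finset.mul_sum]
  refine (Finset.abs_sum_le_sum_abs _ _).trans (Finset.sum_le_sum fun i _ =>
    (Finset.abs_sum_le_sum_abs _ _).trans (Finset.sum_le_sum fun j _ => ?_))
  rw [abs_mul, abs_mul]
  calc |v i| * (|M i j| * |v j|) ≤ 1 * (|M i j| * 1) := by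
        gcongr
        · exact hvi i
        · exact hvi j
    _ = |M i j| := by ring

lemma rayleigh_mem_bounds (M : Matrix (Fin 3) (Fin 3) ℝ) (v : Fin 3 → ℝ) :
    lamMin M * ∑ i, v i ^ 2 ≤ v ⬝ᵥ M.mulVec v ∧ v ⬝ᵥ M.mulVec v ≤ lamMax M * ∑ i, v i ^ 2 := by
  have hS : 0 ≤ ∑ i, v i ^ 2 := Finset.sum_nonneg fun _ _ => sq_nonneg _
  rcases hS.eq_or_lt with h | h
  · have hv : v = 0 := by
      funext i
      have := (Finset.sum_eq_zero_iff_of_nonneg fun i _ => sq_nonneg (v i)).1 h.symm i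
        (Finset.mem_univ i)
      exact pow_eq_zero_iff two_ne_zero |>.1 this
    subst hv
    simp
  · set r := √(∑ i, v i ^ 2) with hr
    have hr0 : 0 < r := Real.sqrt_pos.2 h
    have hr2 : r ^ 2 = ∑ i, v i ^ 2 := Real.sq_sqrt hS
    have hmem : ∑ i, (r⁻¹ • v) i ^ 2 = 1 := by
      simp only [Pi.smul_apply, smul_eq_mul, mul_pow, ← Finset.mul_sum, ← hr2]
      field_simp
    have hval : (r⁻¹ • v) ⬝ᵥ M.mulVec (r⁻¹ • v) * ∑ i, v i ^ 2 = v ⬝ᵥ M.mulVec v := by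
      simp only [Matrix.mulVec_smul, dotProduct_smul, smul_dotProduct, smul_eq_mul]
      rw [← hr2]
      field_simp
    rw [← hval]
    constructor
    · refine mul_le_mul_of_nonneg_right (csInf_le ⟨-∑ i, ∑ j, |M i j|, ?_⟩ ⟨_, hmem, rfl⟩) hS
      rintro _ ⟨v, hv, rfl⟩
      exact (abs_le.1 (abs_rayleigh_le M hv)).1
    · refine mul_le_mul_of_nonneg_right (le_csSup ⟨∑ i, ∑ j, |M i j|, ?_⟩ ⟨_, hmem, rfl⟩) hS
      rintro _ ⟨v, hv, rfl⟩
      exact (abs_le.1 (abs_rayleigh_le M hv)).2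

lemma lamMin_nonneg {M : Matrix (Fin 3) (Fin 3) ℝ} (hM : M.PosDef) : 0 ≤ lamMin M := by
  refine Real.sInf_nonneg ?_
  rintro _ ⟨v, -, rfl⟩
  simpa using hM.posSemidef.dotProduct_mulVec_nonneg v

variable {n : ℕ} {k χ δ g1 lam0 lam1 : ℝ}

lemma lamMin_Phi0_mul_le (n : ℕ) (χ lam0 a b c : ℝ) :
    lamMin (Phi0 n χ lam0) * (a ^ 2 + b ^ 2 + c ^ 2) ≤
      (1 / 2 - 4 * lam0 / (π ^ 2 * n)) * a ^ 2 + 1 / 2 * b ^ 2 + lam0 * c ^ 2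
        + 2 * √n * χ * a * b + ((n : ℝ) - 1) * χ * b * c := by
  have h := (rayleigh_mem_bounds (Phi0 n χ lam0) ![a, b, c]).1
  generalize lamMin (Phi0 n χ lam0) = m at h ⊢
  simp [Phi0, Matrix.mulVec, dotProduct, Fin.sum_univ_three] at h
  linarith

lemma le_lamMax_Phi1_mul (n : ℕ) (χ lam0 a b c : ℝ) :
    1 / 2 * a ^ 2 + 1 / 2 * b ^ 2 + lam0 * c ^ 2
        + 2 * √n * χ * a * b + ((n : ℝ) - 1) * χ * b * c ≤
      lamMax (Phi1 n χ lam0) * (a ^ 2 + b ^ 2 + c ^ 2) := by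
  have h := (rayleigh_mem_bounds (Phi1 n χ lam0) ![a, b, c]).2
  generalize lamMax (Phi1 n χ lam0) = m at h ⊢
  simp [Phi1, Phi0, Matrix.mulVec, dotProduct, Fin.sum_univ_three] at h
  linarith

lemma exists_Psi2_le (h : NegDefM (Psi2 n k χ δ g1 lam1)) :
    ∃ ε > 0, ∀ a b c : ℝ,
      (-χ + δ * (1 + χ * k * ((n : ℝ) - 1)) + 4 * lam1 / (π ^ 2 * n)) * a ^ 2
        + (-χ + δ) * b ^ 2 + (-lam1 + g1 * ((n : ℝ) - 1) * χ) * c ^ 2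
        + 4 * δ * √n * χ * a * b + 2 * √n * g1 * χ * a * c
        + (g1 + 2 * δ * ((n : ℝ) - 1) * χ) * b * c ≤ -ε * (a ^ 2 + b ^ 2 + c ^ 2) := by
  obtain ⟨ε, hε, H⟩ := exists_pos_mul_sum_sq_le_of_posDef h
  refine ⟨ε, hε, fun a b c => ?_⟩
  have h := H ![a, b, c]
  simp [Psi2, Matrix.mulVec, dotProduct, Fin.sum_univ_three] at h
  linarith

end QuadraticForms

section Lyapunov

variable {n : ℕ} {k χ δ g1 lam0 lam1 : ℝ}

/-- The multiplier `2 xᵀ∇u + (n - 1) u`. -/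
def multiplier (u : (Fin n → ℝ) → ℝ) (x : Fin n → ℝ) : ℝ :=
  2 * xGrad u x + ((n : ℝ) - 1) * u x

/-- Density of the Lyapunov function; boundary terms are realized as in `faceInt`. -/
def lyapDensity (k χ : ℝ) (u v : (Fin n → ℝ) → ℝ) (x : Fin n → ℝ) : ℝ :=
  1 / 2 * (gradSq u x + v x ^ 2) + χ * (multiplier u x * v x) +
    χ * k * ((n : ℝ) - 1) / 2 * ∑ p, u (Function.update x p 1) ^ 2

/-- Time derivative of `lyapDensity` when `u` has velocity `v` and acceleration `a`. -/
def lyapRate (k χ : ℝ) (u v a : (Fin n → ℝ) → ℝ) (x : Fin n → ℝ) : ℝ :=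
  ∑ p, pd p u x * pd p v x + v x * a x + χ * (multiplier v x * v x + multiplier u x * a x) +
    χ * k * ((n : ℝ) - 1) * ∑ p, u (Function.update x p 1) * v (Function.update x p 1)

lemma continuous_multiplier {u : (Fin n → ℝ) → ℝ} (hu : ContDiff ℝ 1 u) :
    Continuous (multiplier u) :=
  (continuous_const.mul hu.continuous_xGrad).add (continuous_const.mul hu.continuous)

lemma ContDiff.continuous_gradSq {u : (Fin n → ℝ) → ℝ} (hu : ContDiff ℝ 1 u) :
    Continuous (gradSq u) :=
  continuous_finsetSum _ fun p _ => (hu.continuous_pd p).pow 2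

lemma continuous_sum_face {f : (Fin n → ℝ) → ℝ} (hf : Continuous f) :
    Continuous fun x => ∑ p : Fin n, f (Function.update x p 1) :=
  continuous_finsetSum _ fun p _ => hf.comp (continuous_id.update p continuous_const)

lemma continuous_lyapDensity (k χ : ℝ) {u v : (Fin n → ℝ) → ℝ} (hu : ContDiff ℝ 1 u)
    (hv : Continuous v) : Continuous (lyapDensity k χ u v) := by
  have h1 := hu.continuous_gradSq
  have h2 := continuous_multiplier hu
  have h3 := continuous_sum_face (hu.continuous.pow 2)
  simp only [Pi.pow_apply] at h3
  unfold lyapDensity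
  fun_prop

lemma continuous_lyapRate (k χ : ℝ) {u v a : (Fin n → ℝ) → ℝ} (hu : ContDiff ℝ 1 u)
    (hv : ContDiff ℝ 1 v) (ha : Continuous a) : Continuous (lyapRate k χ u v a) := by
  have h1 := hu.continuous_pd
  have h1' := hv.continuous_pd
  have h2 := continuous_multiplier hu
  have h2' := continuous_multiplier hv
  have h3 := continuous_sum_face (hu.continuous.mul hv.continuous)
  have h4 := hv.continuous
  simp only [Pi.mul_apply] at h3
  unfold lyapRate
  fun_prop

lemma faceInt_eq_integral_sum {h : (Fin n → ℝ) → ℝ} (hh : Continuous h) :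
    faceInt h = ∫ x in cube n, ∑ p, h (Function.update x p 1) := by
  have hf : ∀ p, Continuous fun x => h (Function.update x p 1) := fun p =>
    hh.comp (continuous_id.update p continuous_const)
  rw [faceInt, integral_finsetSum _ fun p _ => (hf p).integrableOn_cube]

lemma abs_multiplier_mul_le (hn : 1 ≤ n) (u : (Fin n → ℝ) → ℝ) {x : Fin n → ℝ}
    (hx : x ∈ cube n) (b : ℝ) :
    |multiplier u x * b| ≤
      2 * √n * √(gradSq u x) * |b| + ((n : ℝ) - 1) * |u x| * |b| := by
  have hn' : (0 : ℝ) ≤ (n : ℝ) - 1 := by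
    have : (1 : ℝ) ≤ n := by exact_mod_cast hn
    linarith
  rw [abs_mul, ← add_mul]
  refine mul_le_mul_of_nonneg_right ?_ (abs_nonneg b)
  refine (abs_add_le _ _).trans ?_
  rw [abs_mul, abs_mul, abs_of_nonneg hn', abs_of_pos (two_pos : (0 : ℝ) < 2)]
  linarith [abs_xGrad_le u hx]

lemma alphaC_mul_energy_le (hn : 1 ≤ n) (hk : 0 ≤ k) (hχ : 0 ≤ χ) (hl0 : 0 ≤ lam0)
    (hΦ0 : (Phi0 n χ lam0).PosDef) {u v : (Fin n → ℝ) → ℝ} (hu : ContDiff ℝ 1 u)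
    (hv : Continuous v) (hu0 : VanishesOnDirichletFaces u) :
    alphaC n χ lam0 * (1 / 2 * ∫ x in cube n, (gradSq u x + v x ^ 2)) ≤
      ∫ x in cube n, lyapDensity k χ u v x := by
  have hn' : (0 : ℝ) ≤ (n : ℝ) - 1 := by
    have : (1 : ℝ) ≤ n := by exact_mod_cast hn
    linarith
  have hG := hu.continuous_gradSq
  have huc := hu.continuous
  have hD := continuous_lyapDensity k χ hu hv
  have hpoint : ∀ x ∈ cube n, lamMin (Phi0 n χ lam0) * (gradSq u x + v x ^ 2) ≤
      lyapDensity k χ u v x + (lam0 * u x ^ 2 - lam0 * (4 / (π ^ 2 * n)) * gradSq u x) := by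
    intro x hx
    have hq := lamMin_Phi0_mul_le n χ lam0 (√(gradSq u x)) (-|v x|) |u x|
    rw [neg_sq, sq_abs, sq_abs, Real.sq_sqrt (gradSq_nonneg u x)] at hq
    have hm : 0 ≤ lamMin (Phi0 n χ lam0) * u x ^ 2 :=
      mul_nonneg (lamMin_nonneg hΦ0) (sq_nonneg _)
    have hface : 0 ≤ χ * k * ((n : ℝ) - 1) / 2 * ∑ p, u (Function.update x p 1) ^ 2 :=
      mul_nonneg (by positivity) (Finset.sum_nonneg fun _ _ => sq_nonneg _)
    have hmul := mul_le_mul_of_nonneg_left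
      ((abs_le.1 ((abs_multiplier_mul_le hn u hx (v x)))).1) hχ
    unfold lyapDensity
    have e : 4 * lam0 / (π ^ 2 * n) = lam0 * (4 / (π ^ 2 * n)) := by ring
    rw [e] at hq
    linarith
  have hint := integral_cube_mono (by fun_prop) (by fun_prop) hpoint
  rw [integral_const_mul, integral_add hD.integrableOn_cube
    (by fun_prop : Continuous fun x => lam0 * u x ^ 2 -
      lam0 * (4 / (π ^ 2 * n)) * gradSq u x).integrableOn_cube,
    integral_sub (by fun_prop : Continuous fun x => lam0 * u x ^ 2).integrableOn_cube
      (by fun_prop : Continuous fun x =>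
        lam0 * (4 / (π ^ 2 * n)) * gradSq u x).integrableOn_cube,
    integral_const_mul, integral_const_mul] at hint
  have hpoin := mul_le_mul_of_nonneg_left (poincare_cube hn hu hu0) hl0
  unfold alphaC
  linarith

lemma integral_lyapDensity_le (hn : 1 ≤ n) (hk : 0 ≤ k) (hχ : 0 ≤ χ) (hl0 : 0 ≤ lam0)
    {u v : (Fin n → ℝ) → ℝ} (hu : ContDiff ℝ 1 u) (hv : Continuous v)
    (hu0 : VanishesOnDirichletFaces u) :
    ∫ x in cube n, lyapDensity k χ u v x ≤
      betaC n k χ lam0 * (1 / 2 * ∫ x in cube n, (gradSq u x + v x ^ 2)) := by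
  have hn' : (0 : ℝ) ≤ (n : ℝ) - 1 := by
    have : (1 : ℝ) ≤ n := by exact_mod_cast hn
    linarith
  have hG := hu.continuous_gradSq
  have huc := hu.continuous
  have hD := continuous_lyapDensity k χ hu hv
  have hS := continuous_sum_face (hu.continuous.pow 2)
  simp only [Pi.pow_apply] at hS
  have hL : 0 ≤ lamMax (Phi1 n χ lam0) := by
    have h := le_lamMax_Phi1_mul n χ lam0 0 1 0
    norm_num at h
    linarith
  have hpoint : ∀ x ∈ cube n, lyapDensity k χ u v x ≤
      lamMax (Phi1 n χ lam0) * ((gradSq u x + v x ^ 2) + u x ^ 2) +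
        χ * k * ((n : ℝ) - 1) / 2 * ∑ p, u (Function.update x p 1) ^ 2 := by
    intro x hx
    have hq := le_lamMax_Phi1_mul n χ lam0 (√(gradSq u x)) |v x| |u x|
    rw [sq_abs, sq_abs, Real.sq_sqrt (gradSq_nonneg u x)] at hq
    have hmul := mul_le_mul_of_nonneg_left
      ((abs_le.1 ((abs_multiplier_mul_le hn u hx (v x)))).2) hχ
    have hu2 : 0 ≤ lam0 * u x ^ 2 := by positivity
    unfold lyapDensity
    linarith
  have hint := integral_cube_mono hD (by fun_prop) hpoint
  have hE : Continuous fun x => gradSq u x + v x ^ 2 := by fun_prop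
  have hU : Continuous fun x => u x ^ 2 := by fun_prop
  rw [integral_add (by fun_prop : Continuous fun x =>
      lamMax (Phi1 n χ lam0) * ((gradSq u x + v x ^ 2) + u x ^ 2)).integrableOn_cube
      (by fun_prop : Continuous fun x => χ * k * ((n : ℝ) - 1) / 2 *
        ∑ p, u (Function.update x p 1) ^ 2).integrableOn_cube,
    integral_const_mul, integral_const_mul,
    integral_add hE.integrableOn_cube hU.integrableOn_cube] at hint
  have hGE : ∫ x in cube n, gradSq u x ≤ ∫ x in cube n, (gradSq u x + v x ^ 2) :=
    integral_cube_mono hG hE fun x _ => by linarith [sq_nonneg (v x)]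
  have hpoin : ∫ x in cube n, u x ^ 2 ≤
      4 / (π ^ 2 * n) * ∫ x in cube n, (gradSq u x + v x ^ 2) :=
    (poincare_cube hn hu hu0).trans (mul_le_mul_of_nonneg_left hGE (by positivity))
  have h1 := mul_le_mul_of_nonneg_left hpoin hL
  have h2 := mul_le_mul_of_nonneg_left ((trace_cube hu hu0).trans hGE)
    (by positivity : 0 ≤ χ * k * ((n : ℝ) - 1) / 2)
  unfold betaC
  linarith

lemma mul_mul_le_sq_add {m : ℝ} (hm : 0 < m) (c a b : ℝ) :
    c * a * b ≤ m * a ^ 2 + c ^ 2 / (4 * m) * b ^ 2 := by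
  have h : m * a ^ 2 + c ^ 2 / (4 * m) * b ^ 2 - c * a * b =
      m * (a - c / (2 * m) * b) ^ 2 := by
    field_simp
    ring
  linarith [mul_nonneg hm.le (sq_nonneg (a - c / (2 * m) * b))]

lemma two_mul_xGrad_mul_sub_gradSq_le (u : (Fin n → ℝ) → ℝ) {x : Fin n → ℝ} (hx : x ∈ cube n)
    (p : Fin n) : 2 * (xGrad u x * pd p u x) - gradSq u x ≤ n * pd p u x ^ 2 := by
  have h : ∑ q, (2 * (x q * pd q u x * pd p u x) - pd q u x ^ 2) ≤
      ∑ _q : Fin n, pd p u x ^ 2 := by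
    refine Finset.sum_le_sum fun q _ => ?_
    have hq := hx q (Set.mem_univ q)
    have h1 : x q ^ 2 ≤ 1 := pow_le_one₀ hq.1 hq.2
    have h2 := mul_le_mul_of_nonneg_right h1 (sq_nonneg (pd p u x))
    nlinarith [sq_nonneg (x q * pd p u x - pd q u x)]
  rw [Finset.sum_sub_distrib, ← Finset.mul_sum, ← Finset.sum_mul, Finset.sum_const,
    Finset.card_univ, Fintype.card_fin, nsmul_eq_mul] at h
  exact h

/-- Gain from the boundary disturbance to the Lyapunov function. -/
def issGain (n : ℕ) (k χ ε : ℝ) : ℝ :=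
  n * χ + (1 - 2 * n * k * χ) ^ 2 / (4 * (k - (1 + k ^ 2 * n) * χ)) +
    (((n : ℝ) - 1) * χ) ^ 2 / (4 * ε)

lemma flux_face_le (hχ : 0 ≤ χ) (hΨ1 : -k + (1 + k ^ 2 * n) * χ < 0) {ε : ℝ} (hε : 0 < ε)
    (u v : (Fin n → ℝ) → ℝ) {y : Fin n → ℝ} (hy : y ∈ cube n) {p : Fin n} (hyp : y p = 1)
    {w : ℝ} (hbc : pd p u y = -k * v y + w) :
    flux χ u v p y + χ * k * ((n : ℝ) - 1) * (u y * v y) ≤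
      ε * u y ^ 2 + issGain n k χ ε * w ^ 2 := by
  have h1 := mul_le_mul_of_nonneg_left (two_mul_xGrad_mul_sub_gradSq_le u hy p) hχ
  have h2 := mul_mul_le_sq_add (sub_pos.2 (by linarith : (1 + k ^ 2 * n) * χ < k))
    (1 - 2 * n * k * χ) (v y) w
  have h3 := mul_mul_le_sq_add hε (((n : ℝ) - 1) * χ) (u y) w
  have h4 : flux χ u v p y + χ * k * ((n : ℝ) - 1) * (u y * v y) =
      χ * (2 * (xGrad u y * pd p u y) - gradSq u y) + v y * (-k * v y + w) + χ * v y ^ 2 +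
        ((n : ℝ) - 1) * χ * u y * w := by
    unfold flux
    rw [hyp, hbc]
    ring
  rw [h4]
  rw [hbc] at h1 ⊢
  unfold issGain
  nlinarith

lemma integral_lyapRate_add_le (hn : 1 ≤ n) (hk : 0 ≤ k) (hδ : 0 ≤ δ)
    (hχ : 0 ≤ χ) (hl1 : 0 ≤ lam1) (hΨ1 : -k + (1 + k ^ 2 * n) * χ < 0) {ε : ℝ} (hε : 0 < ε)
    (hΨ2 : ∀ a b c : ℝ,
      (-χ + δ * (1 + χ * k * ((n : ℝ) - 1)) + 4 * lam1 / (π ^ 2 * n)) * a ^ 2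
        + (-χ + δ) * b ^ 2 + (-lam1 + g1 * ((n : ℝ) - 1) * χ) * c ^ 2
        + 4 * δ * √n * χ * a * b + 2 * √n * g1 * χ * a * c
        + (g1 + 2 * δ * ((n : ℝ) - 1) * χ) * b * c ≤ -ε * (a ^ 2 + b ^ 2 + c ^ 2))
    {u v a g w : (Fin n → ℝ) → ℝ} (hu : ContDiff ℝ 2 u) (hv : ContDiff ℝ 1 v)
    (ha : Continuous a) (hw : Continuous w)
    (hu0 : VanishesOnDirichletFaces u) (hv0 : VanishesOnDirichletFaces v)
    (hg : ∀ x ∈ cube n, |g x| ≤ g1)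
    (hpde : ∀ x ∈ cube n, a x = lap u x + g x * u x)
    (hbc : ∀ x ∈ cube n, ∀ p, x p = 1 → pd p u x = -k * v x + w x) :
    (∫ x in cube n, lyapRate k χ u v a x) + 2 * δ * ∫ x in cube n, lyapDensity k χ u v x ≤
      issGain n k χ ε * faceInt fun x => w x ^ 2 := by
  have hn' : (0 : ℝ) ≤ (n : ℝ) - 1 := by
    have : (1 : ℝ) ≤ n := by exact_mod_cast hn
    linarith
  have hu1 : ContDiff ℝ 1 u := hu.of_le one_le_two
  have hG := hu1.continuous_gradSq
  have huc := hu1.continuous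
  have hvc := hv.continuous
  have hD := continuous_lyapDensity k χ hu1 hvc
  have hR := continuous_lyapRate k χ hu1 hv ha
  have hdiv : Continuous fun x => ∑ p, pd p (flux χ u v p) x :=
    continuous_finsetSum _ fun p _ => (contDiff_flux χ hu hv p).continuous_pd p
  have hflux : Continuous fun x => ∑ p, flux χ u v p (Function.update x p 1) :=
    continuous_finsetSum _ fun p _ => (contDiff_flux χ hu hv p).continuous.comp
      (continuous_id.update p continuous_const)
  have hSuv := continuous_sum_face (huc.mul hvc)
  have hSu := continuous_sum_face (huc.pow 2)
  have hSw := continuous_sum_face (hw.pow 2)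
  simp only [Pi.pow_apply, Pi.mul_apply] at hSuv hSu hSw
  set κ : ℝ := χ * k * ((n : ℝ) - 1) with hκ
  have hκ0 : 0 ≤ κ := by positivity
  have hpoint : ∀ x ∈ cube n, lyapRate k χ u v a x + 2 * δ * lyapDensity k χ u v x ≤
      ∑ p, pd p (flux χ u v p) x + (lam1 * u x ^ 2 -
        (ε + δ * κ + lam1 * (4 / (π ^ 2 * n))) * gradSq u x) +
      (κ * ∑ p, u (Function.update x p 1) * v (Function.update x p 1) +
        δ * κ * ∑ p, u (Function.update x p 1) ^ 2) := by
    intro x hx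
    have hq := hΨ2 (√(gradSq u x)) |v x| |u x|
    rw [sq_abs, sq_abs, Real.sq_sqrt (gradSq_nonneg u x)] at hq
    have e : 4 * lam1 / (π ^ 2 * n) = lam1 * (4 / (π ^ 2 * n)) := by ring
    rw [e] at hq
    have hgu : |g x * u x| ≤ g1 * |u x| := by
      rw [abs_mul]
      exact mul_le_mul_of_nonneg_right (hg x hx) (abs_nonneg _)
    have h1 : v x * (g x * u x) ≤ |v x| * (g1 * |u x|) := by
      refine (le_abs_self _).trans ?_
      rw [abs_mul]
      exact mul_le_mul_of_nonneg_left hgu (abs_nonneg _)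
    have h2 : multiplier u x * (g x * u x) ≤
        2 * √n * √(gradSq u x) * (g1 * |u x|) + ((n : ℝ) - 1) * |u x| * (g1 * |u x|) := by
      refine (le_abs_self _).trans ((abs_multiplier_mul_le hn u hx _).trans ?_)
      gcongr
    have h3 : multiplier u x * v x ≤
        2 * √n * √(gradSq u x) * |v x| + ((n : ℝ) - 1) * |u x| * |v x| :=
      (le_abs_self _).trans (abs_multiplier_mul_le hn u hx _)
    have h2' := mul_le_mul_of_nonneg_left h2 hχ
    have h3' := mul_le_mul_of_nonneg_left h3 (by positivity : 0 ≤ 2 * δ * χ)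
    have h4 : 0 ≤ ε * v x ^ 2 := by positivity
    have h5 : 0 ≤ ε * u x ^ 2 := by positivity
    have h6 : |u x| * |u x| = u x ^ 2 := by rw [← pow_two, sq_abs]
    have h7 : χ * (((n : ℝ) - 1) * |u x| * (g1 * |u x|)) = g1 * ((n : ℝ) - 1) * χ * u x ^ 2 := by
      rw [← h6]; ring
    rw [sum_pd_flux χ hu hv]
    have hrate : lyapRate k χ u v a x = ∑ p, pd p u x * pd p v x + v x * lap u x +
        χ * (2 * v x * xGrad v x + n * v x ^ 2 +
          (2 * xGrad u x + ((n : ℝ) - 1) * u x) * lap u x + gradSq u x)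
        - χ * v x ^ 2 - χ * gradSq u x + v x * (g x * u x) + χ * (multiplier u x * (g x * u x))
        + κ * ∑ p, u (Function.update x p 1) * v (Function.update x p 1) := by
      unfold lyapRate
      rw [hpde x hx]
      unfold multiplier
      ring
    have hdens : 2 * δ * lyapDensity k χ u v x = δ * (gradSq u x + v x ^ 2) +
        2 * δ * χ * (multiplier u x * v x) +
        δ * κ * ∑ p, u (Function.update x p 1) ^ 2 := by
      unfold lyapDensity
      rw [hκ]
      ring
    rw [hrate, hdens]
    linarith
  have hface : ∀ x ∈ cube n, ∑ p, flux χ u v p (Function.update x p 1) +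
      κ * ∑ p, u (Function.update x p 1) * v (Function.update x p 1) ≤
      ε * ∑ p, u (Function.update x p 1) ^ 2 +
        issGain n k χ ε * ∑ p, w (Function.update x p 1) ^ 2 := by
    intro x hx
    simp only [Finset.mul_sum, ← Finset.sum_add_distrib]
    refine Finset.sum_le_sum fun p _ => ?_
    have hy : Function.update x p 1 ∈ cube n := update_mem_cube hx p ⟨zero_le_one, le_rfl⟩
    exact flux_face_le hχ hΨ1 hε u v hy (by simp) (hbc _ hy p (by simp))
  have hI1 := integral_cube_mono (by fun_prop) (by fun_prop) hpoint
  have hI2 := integral_cube_mono (by fun_prop) (by fun_prop) hface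
  have c1 : Continuous fun x => lam1 * u x ^ 2 := by fun_prop
  have c2 : Continuous fun x =>
      (ε + δ * κ + lam1 * (4 / (π ^ 2 * n))) * gradSq u x := by fun_prop
  have c3 : Continuous fun x =>
      κ * ∑ p, u (Function.update x p 1) * v (Function.update x p 1) := by fun_prop
  have c4 : Continuous fun x => δ * κ * ∑ p, u (Function.update x p 1) ^ 2 := by fun_prop
  have c5 : Continuous fun x => ε * ∑ p, u (Function.update x p 1) ^ 2 := by fun_prop
  have c6 : Continuous fun x =>
      issGain n k χ ε * ∑ p, w (Function.update x p 1) ^ 2 := by fun_prop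
  have c12 : Continuous fun x => lam1 * u x ^ 2 -
      (ε + δ * κ + lam1 * (4 / (π ^ 2 * n))) * gradSq u x := c1.sub c2
  have c123 : Continuous fun x => ∑ p, pd p (flux χ u v p) x + (lam1 * u x ^ 2 -
      (ε + δ * κ + lam1 * (4 / (π ^ 2 * n))) * gradSq u x) := hdiv.add c12
  have c34 : Continuous fun x =>
      κ * ∑ p, u (Function.update x p 1) * v (Function.update x p 1) +
        δ * κ * ∑ p, u (Function.update x p 1) ^ 2 := c3.add c4
  have c7 : Continuous fun x => 2 * δ * lyapDensity k χ u v x := by fun_prop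
  rw [integral_add hR.integrableOn_cube c7.integrableOn_cube,
    integral_add c123.integrableOn_cube c34.integrableOn_cube,
    integral_add hdiv.integrableOn_cube c12.integrableOn_cube,
    integral_sub c1.integrableOn_cube c2.integrableOn_cube,
    integral_add c3.integrableOn_cube c4.integrableOn_cube,
    integral_sum_pd_flux χ hu hv hu0 hv0] at hI1
  rw [integral_add hflux.integrableOn_cube c3.integrableOn_cube,
    integral_add c5.integrableOn_cube c6.integrableOn_cube] at hI2
  simp only [integral_const_mul] at hI1 hI2
  rw [faceInt_eq_integral_sum (by fun_prop : Continuous fun x => w x ^ 2)]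
  have hpoin := mul_le_mul_of_nonneg_left (poincare_cube hn hu1 hu0) hl1
  have htr := mul_le_mul_of_nonneg_left (trace_cube hu1 hu0)
    (by positivity : 0 ≤ ε + δ * κ)
  linarith

end Lyapunov

section TimeDependence

variable {n : ℕ}

lemma hasDerivAt_deriv_time {f : ℝ → (Fin n → ℝ) → ℝ}
    (hf : ContDiff ℝ 1 fun q : ℝ × (Fin n → ℝ) => f q.1 q.2) (t : ℝ) (x : Fin n → ℝ) :
    HasDerivAt (fun s => f s x) (deriv (fun s => f s x) t) t :=
  ((hf.comp (contDiff_prodMk_left x)).differentiable one_ne_zero t).hasDerivAt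

lemma deriv_time_eq {f : ℝ → (Fin n → ℝ) → ℝ}
    (hf : ContDiff ℝ 1 fun q : ℝ × (Fin n → ℝ) => f q.1 q.2) (t : ℝ) (x : Fin n → ℝ) :
    deriv (fun s => f s x) t =
      fderiv ℝ (fun q : ℝ × (Fin n → ℝ) => f q.1 q.2) (t, x) (1, 0) := by
  have h : HasDerivAt (fun s : ℝ => (s, x)) ((1 : ℝ), (0 : Fin n → ℝ)) t :=
    (hasDerivAt_id t).prodMk (hasDerivAt_const t x)
  have hd : HasFDerivAt (fun q : ℝ × (Fin n → ℝ) => f q.1 q.2)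
      (fderiv ℝ (fun q : ℝ × (Fin n → ℝ) => f q.1 q.2) (t, x)) (t, x) :=
    (hf.differentiable one_ne_zero (t, x)).hasFDerivAt
  exact (HasFDerivAt.comp_hasDerivAt (f := fun s : ℝ => (s, x)) t hd h).deriv

lemma pd_eq_fderiv {f : ℝ → (Fin n → ℝ) → ℝ}
    (hf : ContDiff ℝ 1 fun q : ℝ × (Fin n → ℝ) => f q.1 q.2) (p : Fin n) (t : ℝ)
    (x : Fin n → ℝ) :
    pd p (f t) x =
      fderiv ℝ (fun q : ℝ × (Fin n → ℝ) => f q.1 q.2) (t, x) (0, Pi.single p 1) := by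
  have h := (hf.differentiable one_ne_zero (t, x)).hasFDerivAt.comp x
    ((hasFDerivAt_const t x).prodMk (hasFDerivAt_id x))
  have h' : fderiv ℝ (f t) x = _ := h.fderiv
  simp [pd, h']

lemma ContDiff.contDiff_deriv_time {f : ℝ → (Fin n → ℝ) → ℝ}
    (hf : ContDiff ℝ 2 fun q : ℝ × (Fin n → ℝ) => f q.1 q.2) :
    ContDiff ℝ 1 fun q : ℝ × (Fin n → ℝ) => deriv (fun s => f s q.2) q.1 := by
  simp only [deriv_time_eq (hf.of_le one_le_two)]
  exact (hf.fderiv_right (m := 1) (by norm_num)).clm_apply contDiff_const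

lemma ContDiff.continuous_deriv_time {f : ℝ → (Fin n → ℝ) → ℝ}
    (hf : ContDiff ℝ 1 fun q : ℝ × (Fin n → ℝ) => f q.1 q.2) :
    Continuous fun q : ℝ × (Fin n → ℝ) => deriv (fun s => f s q.2) q.1 := by
  simp only [deriv_time_eq hf]
  exact (hf.continuous_fderiv one_ne_zero).clm_apply continuous_const

lemma ContDiff.contDiff_pd_time {f : ℝ → (Fin n → ℝ) → ℝ}
    (hf : ContDiff ℝ 2 fun q : ℝ × (Fin n → ℝ) => f q.1 q.2) (p : Fin n) :
    ContDiff ℝ 1 fun q : ℝ × (Fin n → ℝ) => pd p (f q.1) q.2 := by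
  simp only [pd_eq_fderiv (hf.of_le one_le_two)]
  exact (hf.fderiv_right (m := 1) (by norm_num)).clm_apply contDiff_const

lemma ContDiff.continuous_pd_time {f : ℝ → (Fin n → ℝ) → ℝ}
    (hf : ContDiff ℝ 1 fun q : ℝ × (Fin n → ℝ) => f q.1 q.2) (p : Fin n) :
    Continuous fun q : ℝ × (Fin n → ℝ) => pd p (f q.1) q.2 := by
  simp only [pd_eq_fderiv hf]
  exact (hf.continuous_fderiv one_ne_zero).clm_apply continuous_const

/-- Time and space derivatives of a `C²` function commute. -/
lemma hasDerivAt_pd_time {f : ℝ → (Fin n → ℝ) → ℝ}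
    (hf : ContDiff ℝ 2 fun q : ℝ × (Fin n → ℝ) => f q.1 q.2) (p : Fin n) (t : ℝ)
    (x : Fin n → ℝ) :
    HasDerivAt (fun s => pd p (f s) x) (pd p (fun y => deriv (fun s => f s y) t) x) t := by
  have hf1 := hf.of_le one_le_two
  have hsymm : IsSymmSndFDerivAt ℝ (fun q : ℝ × (Fin n → ℝ) => f q.1 q.2) (t, x) :=
    hf.contDiffAt.isSymmSndFDerivAt (by simp)
  have hd : DifferentiableAt ℝ (fderiv ℝ fun q : ℝ × (Fin n → ℝ) => f q.1 q.2) (t, x) :=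
    (hf.fderiv_right (m := 1) (by norm_num)).differentiable one_ne_zero _
  have happ : ∀ a b : ℝ × (Fin n → ℝ),
      fderiv ℝ (fun q => fderiv ℝ (fun q : ℝ × (Fin n → ℝ) => f q.1 q.2) q b) (t, x) a =
        fderiv ℝ (fderiv ℝ fun q : ℝ × (Fin n → ℝ) => f q.1 q.2) (t, x) a b := by
    intro a b
    rw [fderiv_clm_apply hd (differentiableAt_const _)]
    simp
  have h := hasDerivAt_deriv_time (f := fun s x => pd p (f s) x) (hf.contDiff_pd_time p) t x
  refine h.congr_deriv ?_
  rw [deriv_time_eq (f := fun s x => pd p (f s) x) (hf.contDiff_pd_time p),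
    pd_eq_fderiv (f := fun t y => deriv (fun s => f s y) t) hf.contDiff_deriv_time]
  simp only [pd_eq_fderiv hf1, deriv_time_eq hf1, happ]
  exact hsymm.eq _ _

lemma HasDerivAt.eq_zero_of_eqOn_Ici {f : ℝ → ℝ} {f' t : ℝ} (hf : HasDerivAt f f' t)
    (h : ∀ s, t ≤ s → f s = 0) : f' = 0 :=
  (uniqueDiffWithinAt_Ici t).eq_deriv _ hf.hasDerivWithinAt
    ((hasDerivWithinAt_const t (Set.Ici t) (0 : ℝ)).congr_of_mem (fun s hs => h s hs)
      Set.self_mem_Ici)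

/-- Differentiation under the integral over the cube. -/
lemma hasDerivAt_integral_cube {F F' : ℝ → (Fin n → ℝ) → ℝ} (hF : ∀ t, Continuous (F t))
    (hF' : Continuous fun q : ℝ × (Fin n → ℝ) => F' q.1 q.2)
    (hd : ∀ t x, HasDerivAt (fun s => F s x) (F' t x) t) (t : ℝ) :
    HasDerivAt (fun s => ∫ x in cube n, F s x) (∫ x in cube n, F' t x) t := by
  obtain ⟨C, hC⟩ := (isCompact_Icc.prod (isCompact_cube n)).exists_bound_of_continuousOn
    (s := Set.Icc (t - 1) (t + 1) ×ˢ cube n) hF'.continuousOn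
  have hF't : Continuous (F' t) := hF'.comp (Continuous.prodMk_right t)
  refine (hasDerivAt_integral_of_dominated_loc_of_deriv_le (bound := fun _ => C)
    (Icc_mem_nhds (by linarith) (by linarith) : Set.Icc (t - 1) (t + 1) ∈ nhds t)
    (Filter.Eventually.of_forall fun s => (hF s).aestronglyMeasurable)
    (hF t).integrableOn_cube hF't.aestronglyMeasurable ?_ ?_ ?_).2
  · exact (ae_restrict_iff' (measurableSet_cube n)).2
      (Filter.Eventually.of_forall fun x hx s hs => hC (s, x) ⟨hs, hx⟩)
  · exact continuous_const.integrableOn_cube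
  · exact Filter.Eventually.of_forall fun x s _ => hd s x

lemma hasDerivAt_integral_lyapDensity (k χ : ℝ) {e : ℝ → (Fin n → ℝ) → ℝ}
    (he : ContDiff ℝ 2 fun q : ℝ × (Fin n → ℝ) => e q.1 q.2) (t : ℝ) :
    HasDerivAt
      (fun s => ∫ x in cube n, lyapDensity k χ (e s) (fun y => deriv (fun r => e r y) s) x)
      (∫ x in cube n, lyapRate k χ (e t) (fun y => deriv (fun r => e r y) t)
        (fun y => deriv (deriv fun r => e r y) t) x) t := by
  have he1 : ContDiff ℝ 1 fun q : ℝ × (Fin n → ℝ) => e q.1 q.2 := he.of_le one_le_two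
  set v : ℝ → (Fin n → ℝ) → ℝ := fun t x => deriv (fun s => e s x) t with hv
  have hvC : ContDiff ℝ 1 fun q : ℝ × (Fin n → ℝ) => v q.1 q.2 := he.contDiff_deriv_time
  have hpe := he1.continuous_pd_time
  have hpv := hvC.continuous_pd_time
  have hac : Continuous fun q : ℝ × (Fin n → ℝ) => deriv (fun s => v s q.2) q.1 :=
    hvC.continuous_deriv_time
  have hec := he1.continuous
  have hvc := hvC.continuous
  have hface : ∀ {f : ℝ → (Fin n → ℝ) → ℝ},
      (Continuous fun q : ℝ × (Fin n → ℝ) => f q.1 q.2) → ∀ p : Fin n,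
      Continuous fun q : ℝ × (Fin n → ℝ) => f q.1 (Function.update q.2 p 1) := fun hf p =>
    hf.comp (continuous_fst.prodMk (continuous_snd.update p continuous_const))
  refine hasDerivAt_integral_cube
    (F := fun s x => lyapDensity k χ (e s) (v s) x)
    (F' := fun s x => lyapRate k χ (e s) (v s) (fun y => deriv (fun r => v r y) s) x)
    (fun s => continuous_lyapDensity k χ (he1.comp (contDiff_prodMk_right s))
      (hvC.comp (contDiff_prodMk_right s)).continuous) ?_ (fun s x => ?_) t
  · have h1 := hface hec
    have h2 := hface hvc
    unfold lyapRate multiplier xGrad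
    fun_prop
  · have de := hasDerivAt_deriv_time he1
    have dv := hasDerivAt_deriv_time hvC s x
    have dp : ∀ p, HasDerivAt (fun s => pd p (e s) x) (pd p (v s) x) s := fun p =>
      hasDerivAt_pd_time he p s x
    have dG : HasDerivAt (fun s => gradSq (e s) x)
        (∑ p, ((2 : ℕ) : ℝ) * pd p (e s) x ^ (2 - 1) * pd p (v s) x) s :=
      HasDerivAt.fun_sum fun p _ => (dp p).fun_pow 2
    have dX : HasDerivAt (fun s => xGrad (e s) x) (xGrad (v s) x) s :=
      HasDerivAt.fun_sum fun p _ => (dp p).const_mul (x p)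
    have dM : HasDerivAt (fun s => multiplier (e s) x) (multiplier (v s) x) s :=
      (dX.const_mul 2).add ((de s x).const_mul ((n : ℝ) - 1))
    have dS : HasDerivAt (fun s => ∑ p, e s (Function.update x p 1) ^ 2)
        (∑ p, ((2 : ℕ) : ℝ) * e s (Function.update x p 1) ^ (2 - 1) *
          v s (Function.update x p 1)) s :=
      HasDerivAt.fun_sum fun p _ => (de s (Function.update x p 1)).fun_pow 2
    have h := (((dG.add (dv.fun_pow 2)).const_mul (1 / 2)).add ((dM.mul dv).const_mul χ)).add
      (dS.const_mul (χ * k * ((n : ℝ) - 1) / 2))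
    refine h.congr_deriv ?_
    unfold lyapRate
    simp only [Nat.cast_ofNat, Nat.add_one_sub_one, pow_one, mul_assoc, ← Finset.mul_sum]
    ring

lemma continuous_faceInt {h : (Fin n → ℝ) → ℝ → ℝ}
    (hh : Continuous fun q : (Fin n → ℝ) × ℝ => h q.1 q.2) :
    Continuous fun s => faceInt fun x => h x s :=
  continuous_finsetSum _ fun p _ => continuous_parametric_integral_of_continuous
    (f := fun s x => h (Function.update x p 1) s)
    (hh.comp ((continuous_snd.update p continuous_const).prodMk continuous_fst))
    (isCompact_cube n)

/-- A Grönwall estimate with an integrated nonnegative source. -/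
lemma le_exp_mul_add_integral_of_hasDerivAt {δ γ t0 t : ℝ} (hδ : 0 ≤ δ) (hγ : 0 ≤ γ)
    {V V' P : ℝ → ℝ} (hV : ∀ s, HasDerivAt V (V' s) s) (hP : Continuous P) (hP0 : ∀ s, 0 ≤ P s)
    (hineq : ∀ s, t0 < s → V' s + 2 * δ * V s ≤ γ * P s) (ht : t0 ≤ t) :
    V t ≤ Real.exp (-2 * δ * (t - t0)) * V t0 + γ * ∫ s in t0..t, P s := by
  have hZ : ∀ s, HasDerivAt
      (fun s => Real.exp (2 * δ * (s - t0)) * (V s - γ * ∫ r in t0..s, P r))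
      (Real.exp (2 * δ * (s - t0)) * (2 * δ * 1) * (V s - γ * ∫ r in t0..s, P r) +
        Real.exp (2 * δ * (s - t0)) * (V' s - γ * P s)) s := fun s =>
    ((((hasDerivAt_id s).sub_const t0).const_mul (2 * δ)).exp).mul
      ((hV s).sub ((intervalIntegral.integral_hasDerivAt_right (hP.intervalIntegrable _ _)
        (hP.stronglyMeasurableAtFilter _ _) hP.continuousAt).const_mul γ))
  have hanti := antitoneOn_of_deriv_nonpos (convex_Ici t0)
    (fun s _ => (hZ s).continuousAt.continuousWithinAt)
    (fun s _ => (hZ s).differentiableAt.differentiableWithinAt) (fun s hs => by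
      rw [interior_Ici] at hs
      rw [(hZ s).deriv]
      have hint : 0 ≤ 2 * δ * (γ * ∫ r in t0..s, P r) :=
        mul_nonneg (by positivity) (mul_nonneg hγ
          (intervalIntegral.integral_nonneg (le_of_lt hs) fun r _ => hP0 r))
      have h := mul_le_mul_of_nonneg_left (hineq s hs) (Real.exp_pos (2 * δ * (s - t0))).le
      have h' := mul_nonneg (Real.exp_pos (2 * δ * (s - t0))).le hint
      linarith)
  have h := hanti Set.self_mem_Ici ht ht
  simp only [sub_self, mul_zero, Real.exp_zero, one_mul, intervalIntegral.integral_same,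
    sub_zero] at h
  have h2 := mul_le_mul_of_nonneg_left h (Real.exp_pos (-2 * δ * (t - t0))).le
  rw [← mul_assoc, ← Real.exp_add] at h2
  have h3 : -2 * δ * (t - t0) + 2 * δ * (t - t0) = 0 := by ring
  rw [h3, Real.exp_zero, one_mul] at h2
  linarith

lemma issGain_pos {k χ ε : ℝ} (hn : 1 ≤ n) (hχ : 0 < χ) (hΨ1 : -k + (1 + k ^ 2 * n) * χ < 0)
    (hε : 0 < ε) : 0 < issGain n k χ ε := by
  have hn' : (0 : ℝ) < n := by exact_mod_cast hn
  have hm : 0 < k - (1 + k ^ 2 * n) * χ := by linarith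
  unfold issGain
  positivity

end TimeDependence

/-- **Input-to-state stability of the perturbed error system (Remark 2).** Under
the strict LMIs `Φ₀ > 0`, `Ψ₁ < 0`, `Ψ₂ ≺ 0`, there exists `γ > 0` (depending
only on `(n,k,δ,g₁,χ,λ₀,λ₁)`) such that for every continuous boundary
disturbance `w` and every classical (C²) solution of
`e_tt = Δe + g(x,t)e` with `|g| ≤ g₁`, `e = 0` on `Γ_D` and
`e_{x_p} = −k e_t + w` on each face `{x_p = 1}`, one has for all `t ≥ t₀`:
`α E(t) ≤ β e^{−2δ(t−t₀)} E(t₀) + γ ∫_{t₀}^t ∫_{Γ_N} w² dΓ ds`, where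
`E(t) = ½∫_Ω (|∇e|² + e_t²) dx`. -/
theorem iss_perturbed_nd (n : ℕ) (hn : 1 ≤ n) (k δ g1 : ℝ)
    (hk : 0 < k) (hδ : 0 < δ) (hg1 : 0 < g1)
    (χ lam0 lam1 : ℝ) (hχ : 0 < χ) (hl0 : 0 < lam0) (hl1 : 0 < lam1)
    (hΦ0 : (Phi0 n χ lam0).PosDef)
    (hΨ1 : -k + (1 + k ^ 2 * n) * χ < 0)
    (hΨ2 : NegDefM (Psi2 n k χ δ g1 lam1)) :
    ∃ γ > 0, ∀ (t0 : ℝ) (w : (Fin n → ℝ) → ℝ → ℝ),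
      (Continuous fun q : (Fin n → ℝ) × ℝ => w q.1 q.2) →
      ∀ (e : ℝ → (Fin n → ℝ) → ℝ),
      (ContDiff ℝ 2 fun q : ℝ × (Fin n → ℝ) => e q.1 q.2) →
      ∀ (g : (Fin n → ℝ) → ℝ → ℝ),
      (Continuous fun q : (Fin n → ℝ) × ℝ => g q.1 q.2) →
      (∀ x ∈ cube n, ∀ t, t0 ≤ t → |g x t| ≤ g1) →
      (∀ t, t0 < t → ∀ x ∈ cube n,
        deriv (deriv fun s => e s x) t = lap (e t) x + g x t * e t x) →
      (∀ t, t0 ≤ t → ∀ x ∈ cube n, (∃ p, x p = 0) → e t x = 0) →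
      (∀ t, t0 ≤ t → ∀ x ∈ cube n, ∀ p, x p = 1 →
        pd p (e t) x = -k * deriv (fun s => e s x) t + w x t) →
      ∀ t, t0 ≤ t →
        alphaC n χ lam0 *
            ((1/2) * ∫ x in cube n, (gradSq (e t) x + (deriv (fun s => e s x) t) ^ 2)) ≤
          betaC n k χ lam0 * Real.exp (-2 * δ * (t - t0)) *
            ((1/2) * ∫ x in cube n, (gradSq (e t0) x + (deriv (fun s => e s x) t0) ^ 2)) +
          γ * ∫ s in t0..t, faceInt (fun x => (w x s) ^ 2) := by
  obtain ⟨ε, hε, hquad⟩ := exists_Psi2_le hΨ2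
  refine ⟨issGain n k χ ε, issGain_pos hn hχ hΨ1 hε, ?_⟩
  intro t0 w hw e he g _ hg hpde hD hN t ht
  set v : ℝ → (Fin n → ℝ) → ℝ := fun t x => deriv (fun s => e s x) t with hv
  set a : ℝ → (Fin n → ℝ) → ℝ := fun t x => deriv (fun s => v s x) t with ha
  have hvC : ContDiff ℝ 1 fun q : ℝ × (Fin n → ℝ) => v q.1 q.2 := he.contDiff_deriv_time
  have heC : ContDiff ℝ 1 fun q : ℝ × (Fin n → ℝ) => e q.1 q.2 := he.of_le one_le_two
  have hes : ∀ t, ContDiff ℝ 2 (e t) := fun t => he.comp (contDiff_prodMk_right t)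
  have hvs : ∀ t, ContDiff ℝ 1 (v t) := fun t => hvC.comp (contDiff_prodMk_right t)
  have has : ∀ t, Continuous (a t) := fun t =>
    hvC.continuous_deriv_time.comp (Continuous.prodMk_right t)
  have hws : ∀ t, Continuous fun x => w x t := fun t => hw.comp (Continuous.prodMk_left t)
  have he0 : ∀ t, t0 ≤ t → VanishesOnDirichletFaces (e t) := fun t ht x hx h => hD t ht x hx h
  have hv0 : ∀ t, t0 ≤ t → VanishesOnDirichletFaces (v t) := fun t ht x hx h =>
    (hasDerivAt_deriv_time heC t x).eq_zero_of_eqOn_Ici fun s hs =>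
      hD s (ht.trans hs) x hx h
  have hV := hasDerivAt_integral_lyapDensity k χ he
  have hP : Continuous fun s => faceInt fun x => w x s ^ 2 := continuous_faceInt (hw.pow 2)
  have hP0 : ∀ s, 0 ≤ faceInt fun x => w x s ^ 2 := fun s =>
    Finset.sum_nonneg fun p _ => integral_nonneg fun x => sq_nonneg _
  have hgron := le_exp_mul_add_integral_of_hasDerivAt hδ.le (issGain_pos hn hχ hΨ1 hε).le hV hP hP0
    (fun s hs => integral_lyapRate_add_le hn hk.le hδ.le hχ.le hl1.le hΨ1 hε hquad
      (hes s) (hvs s) (has s) (hws s) (he0 s hs.le) (hv0 s hs.le)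
      (fun x hx => hg x hx s hs.le) (hpde s hs) (hN s hs.le)) ht
  have hlow := alphaC_mul_energy_le hn hk.le hχ.le hl0.le hΦ0 ((hes t).of_le one_le_two)
    (hvs t).continuous (he0 t ht)
  have hup := mul_le_mul_of_nonneg_left (integral_lyapDensity_le hn hk.le hχ.le hl0.le
    ((hes t0).of_le one_le_two) (hvs t0).continuous (he0 t0 le_rfl))
    (Real.exp_pos (-2 * δ * (t - t0))).le
  refine hlow.trans (hgron.trans ?_)
  linarith
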